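/- arXiv:nlin/0305031 — 2 statements merged into one kernel-verified Lean document; each statement's English description precedes it below -/
import Mathlib

section
/- Let τ ∈ ℂ with Im τ > 0 and let θ(z) = θ₁(z,τ). Then for all w, X, Y, Y', Z, Z' ∈ ℂ the double Fay identity holds: θ(w−X)·θ(w−Y+Z'−Z)·θ(w−Z+Y'−Y)·θ(Y−Z)·θ(X−Z')·θ(X−Y') − θ(w−X+Z'−Z)·θ(w−Y)·θ(w−Z+Y'−Y)·θ(X−Z)·θ(Y−Z')·θ(X−Y') − θ(w−X+Y'−Y)·θ(w−Y+Z'−Z)·θ(w−Z)·θ(X−Y)·θ(Y'−Z)·θ(X−Z') + θ(w−X+Y'−Y+Z'−Z)·θ(w−Y)·θ(w−Z)·θ(X−Z)·θ(X−Y)·θ(Y'−Z') = 0. -/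
/-- The odd Jacobi theta function
`θ₁(z,τ) = -i ∑_{n ∈ ℤ} (-1)^n exp(iπτ(n+1/2)²) exp((2n+1)iπz)`. -/
noncomputable def theta1 (z τ : ℂ) : ℂ :=
  -Complex.I * ∑' n : ℤ,
    (-1 : ℂ) ^ n * Complex.exp ((Real.pi : ℂ) * Complex.I * τ * ((n : ℂ) + 1 / 2) ^ 2) *
      Complex.exp ((2 * (n : ℂ) + 1) * (Real.pi : ℂ) * Complex.I * z)

lemma HasSum.mul_complex {ι κ : Type*} {f : ι → ℂ} {g : κ → ℂ} {a b : ℂ} (hf : HasSum f a)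
    (hg : HasSum g b) : HasSum (fun p : ι × κ ↦ f p.1 * g p.2) (a * b) :=
  hf.mul hg (summable_mul_of_summable_norm hf.summable.norm hg.summable.norm)

/-- Summation over `ℤ × ℤ`, split according to the parity of the sum of the indices. -/
lemma HasSum.int_prod_of_even_odd {M : Type*} [AddCommMonoid M] [TopologicalSpace M]
    [ContinuousAdd M] {f : ℤ × ℤ → M} {a b : M}
    (ha : HasSum (fun p : ℤ × ℤ ↦ f (p.1 + p.2, p.1 - p.2)) a)
    (hb : HasSum (fun p : ℤ × ℤ ↦ f (p.1 + p.2 + 1, p.1 - p.2)) b) : HasSum f (a + b) := by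
  let even (p : ℤ × ℤ) : ℤ × ℤ := (p.1 + p.2, p.1 - p.2)
  let odd (p : ℤ × ℤ) : ℤ × ℤ := (p.1 + p.2 + 1, p.1 - p.2)
  have even_inj : even.Injective := by
    rintro ⟨a, b⟩ ⟨c, d⟩ h
    simp only [even, Prod.mk.injEq] at h ⊢
    omega
  have odd_inj : odd.Injective := by
    rintro ⟨a, b⟩ ⟨c, d⟩ h
    simp only [odd, Prod.mk.injEq] at h ⊢
    omega
  have hcompl : IsCompl (Set.range even) (Set.range odd) := by
    refine ⟨Set.disjoint_left.2 ?_, codisjoint_iff_le_sup.2 ?_⟩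
    · rintro _ ⟨⟨a, b⟩, rfl⟩ ⟨⟨c, d⟩, h⟩
      simp only [even, odd, Prod.mk.injEq] at h
      omega
    · rintro ⟨n, m⟩ -
      rcases Int.even_or_odd' (n + m) with ⟨k, hk | hk⟩
      · exact Or.inl ⟨(k, n - k), Prod.ext (by dsimp [even]; omega) (by dsimp [even]; omega)⟩
      · exact Or.inr ⟨(k, n - k - 1), Prod.ext (by dsimp [odd]; omega) (by dsimp [odd]; omega)⟩
  exact HasSum.add_isCompl hcompl (even_inj.hasSum_range_iff.2 ha) (odd_inj.hasSum_range_iff.2 hb)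

open Complex Real in
/-- Duplication formula: a product of theta functions of modulus `τ` as a combination of products of
theta functions of modulus `2τ`. -/
lemma jacobiTheta₂_add_mul_jacobiTheta₂_sub {τ : ℂ} (hτ : 0 < τ.im) (x y : ℂ) :
    jacobiTheta₂ (x + y) τ * jacobiTheta₂ (x - y) τ =
      jacobiTheta₂ (2 * x) (2 * τ) * jacobiTheta₂ (2 * y) (2 * τ) +
        cexp (π * I * τ + 2 * π * I * (x + y)) *
          (jacobiTheta₂ (2 * x + τ) (2 * τ) * jacobiTheta₂ (2 * y + τ) (2 * τ)) := by
  have hτ' : 0 < (2 * τ).im := by simpa using hτ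
  have hmul {σ : ℂ} (hσ : 0 < σ.im) (u v : ℂ) :=
    (hasSum_jacobiTheta₂_term u hσ).mul_complex (hasSum_jacobiTheta₂_term v hσ)
  refine (hmul hτ (x + y) (x - y)).unique (HasSum.int_prod_of_even_odd ?_ ?_)
  · refine (hmul hτ' (2 * x) (2 * y)).congr_fun fun p ↦ ?_
    simp only [jacobiTheta₂_term, ← Complex.exp_add]
    push_cast
    ring_nf
  · refine ((hmul hτ' (2 * x + τ) (2 * y + τ)).mul_left _).congr_fun fun p ↦ ?_
    simp only [jacobiTheta₂_term, ← Complex.exp_add]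
    push_cast
    ring_nf

open Complex Real in
lemma theta1_eq_jacobiTheta₂ (z τ : ℂ) :
    theta1 z τ = -I * cexp (π * I * τ / 4 + π * I * z) * jacobiTheta₂ (z + τ / 2 + 1 / 2) τ := by
  rw [theta1, jacobiTheta₂, ← tsum_mul_left, ← tsum_mul_left]
  refine tsum_congr fun n ↦ ?_
  rw [jacobiTheta₂_term, ← Complex.exp_pi_mul_I, ← Complex.exp_int_mul]
  simp only [mul_assoc, ← Complex.exp_add]
  ring_nf

open Complex Real in
lemma theta1_add_mul_theta1_sub {τ : ℂ} (hτ : 0 < τ.im) (x y : ℂ) :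
    theta1 (x + y) τ * theta1 (x - y) τ =
      jacobiTheta₂ (2 * x) (2 * τ) *
          (cexp (π * I * τ / 2 + 2 * π * I * y) * jacobiTheta₂ (2 * y + τ) (2 * τ)) -
        cexp (π * I * τ / 2 + 2 * π * I * x) * jacobiTheta₂ (2 * x + τ) (2 * τ) *
          jacobiTheta₂ (2 * y) (2 * τ) := by
  have hdup := jacobiTheta₂_add_mul_jacobiTheta₂_sub hτ (x + τ / 2 + 1 / 2) y
  have hone : jacobiTheta₂ (2 * (x + τ / 2 + 1 / 2)) (2 * τ) =
      jacobiTheta₂ (2 * x + τ) (2 * τ) := by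
    rw [← jacobiTheta₂_add_left (2 * x + τ)]
    ring_nf
  have htau : jacobiTheta₂ (2 * (x + τ / 2 + 1 / 2) + τ) (2 * τ) =
      cexp (-π * I * (2 * τ + 2 * (2 * x))) * jacobiTheta₂ (2 * x) (2 * τ) := by
    rw [← jacobiTheta₂_add_left', ← jacobiTheta₂_add_left (2 * x + 2 * τ)]
    ring_nf
  have hexp : cexp (π * I * τ / 4 + π * I * (x + y)) * cexp (π * I * τ / 4 + π * I * (x - y)) =
      cexp (π * I * τ / 2 + 2 * π * I * x) := by
    rw [← Complex.exp_add]
    ring_nf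
  have hexp' : cexp (π * I * τ / 2 + 2 * π * I * x) *
      (cexp (π * I * τ + 2 * π * I * (x + τ / 2 + 1 / 2 + y)) *
        cexp (-π * I * (2 * τ + 2 * (2 * x)))) = -cexp (π * I * τ / 2 + 2 * π * I * y) := by
    rw [← mul_neg_one (cexp _), ← Complex.exp_pi_mul_I]
    simp only [← Complex.exp_add]
    ring_nf
  rw [hone, htau] at hdup
  rw [theta1_eq_jacobiTheta₂, theta1_eq_jacobiTheta₂,
    show x + y + τ / 2 + 1 / 2 = x + τ / 2 + 1 / 2 + y by ring,
    show x - y + τ / 2 + 1 / 2 = x + τ / 2 + 1 / 2 - y by ring]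
  set A := cexp (π * I * τ / 4 + π * I * (x + y))
  set B := cexp (π * I * τ / 4 + π * I * (x - y))
  set E₁ := cexp (π * I * τ + 2 * π * I * (x + τ / 2 + 1 / 2 + y))
  set E₂ := cexp (-π * I * (2 * τ + 2 * (2 * x)))
  set S := jacobiTheta₂ (2 * x + τ) (2 * τ) * jacobiTheta₂ (2 * y) (2 * τ)
  set T := jacobiTheta₂ (2 * x) (2 * τ) * jacobiTheta₂ (2 * y + τ) (2 * τ)
  linear_combination I ^ 2 * A * B * hdup + A * B * (S + E₁ * E₂ * T) * I_sq -
    (S + E₁ * E₂ * T) * hexp - T * hexp'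

/-- The Weierstrass three-term identity for `θ₁`. -/
lemma theta1_weierstrass {τ : ℂ} (hτ : 0 < τ.im) (a b c d : ℂ) :
    theta1 (a + b) τ * theta1 (a - b) τ * (theta1 (c + d) τ * theta1 (c - d) τ) =
      theta1 (a + c) τ * theta1 (a - c) τ * (theta1 (b + d) τ * theta1 (b - d) τ) +
        theta1 (a + d) τ * theta1 (a - d) τ * (theta1 (c + b) τ * theta1 (c - b) τ) := by
  simp only [theta1_add_mul_theta1_sub hτ]
  ring

/-- The Fay trisecant identity in genus one. -/
lemma theta1_fay {τ : ℂ} (hτ : 0 < τ.im) (w X Y Z Z' : ℂ) :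
    theta1 (w - X) τ * theta1 (w - Y + Z' - Z) τ * theta1 (Y - Z) τ * theta1 (X - Z') τ -
        theta1 (w - X + Z' - Z) τ * theta1 (w - Y) τ * theta1 (X - Z) τ * theta1 (Y - Z') τ =
      theta1 (w - Z) τ * theta1 (w - X - Y + Z') τ * theta1 (X - Y) τ * theta1 (Z' - Z) τ := by
  have h := theta1_weierstrass hτ ((2 * w - X - Y + Z' - Z) / 2) ((X - Y + Z' - Z) / 2)
    ((X + Y - Z - Z') / 2) ((X - Y + Z - Z') / 2)
  ring_nf at h ⊢
  linear_combination h

/-- The genus-one double Fay identity for `θ(z) = θ₁(z,τ)`,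
`Im τ > 0`: for all `w, X, Y, Y', Z, Z' ∈ ℂ`,
`θ(w-X)θ(w-Y+Z'-Z)θ(w-Z+Y'-Y)θ(Y-Z)θ(X-Z')θ(X-Y')
 - θ(w-X+Z'-Z)θ(w-Y)θ(w-Z+Y'-Y)θ(X-Z)θ(Y-Z')θ(X-Y')
 - θ(w-X+Y'-Y)θ(w-Y+Z'-Z)θ(w-Z)θ(X-Y)θ(Y'-Z)θ(X-Z')
 + θ(w-X+Y'-Y+Z'-Z)θ(w-Y)θ(w-Z)θ(X-Z)θ(X-Y)θ(Y'-Z') = 0`. -/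
theorem theta1_double_fay_identity (τ : ℂ) (hτ : 0 < τ.im) :
    ∀ w X Y Y' Z Z' : ℂ,
      theta1 (w - X) τ * theta1 (w - Y + Z' - Z) τ * theta1 (w - Z + Y' - Y) τ *
          theta1 (Y - Z) τ * theta1 (X - Z') τ * theta1 (X - Y') τ
        - theta1 (w - X + Z' - Z) τ * theta1 (w - Y) τ * theta1 (w - Z + Y' - Y) τ *
          theta1 (X - Z) τ * theta1 (Y - Z') τ * theta1 (X - Y') τ
        - theta1 (w - X + Y' - Y) τ * theta1 (w - Y + Z' - Z) τ * theta1 (w - Z) τ *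
          theta1 (X - Y) τ * theta1 (Y' - Z) τ * theta1 (X - Z') τ
        + theta1 (w - X + Y' - Y + Z' - Z) τ * theta1 (w - Y) τ * theta1 (w - Z) τ *
          theta1 (X - Z) τ * theta1 (X - Y) τ * theta1 (Y' - Z') τ = 0 := by
  intro w X Y Y' Z Z'
  have h := theta1_fay hτ w X Y Z Z'
  have h' := theta1_fay hτ (w + Y' - Y) X Y' Z Z'
  rw [show w + Y' - Y - Y' = w - Y by ring] at h'
  ring_nf at h h' ⊢
  linear_combination theta1 (w - Y - Z + Y') τ * theta1 (X - Y') τ * h -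
    theta1 (w - Z) τ * theta1 (X - Y) τ * h'
end

section
/- Fused modified tetrahedron equation for open boxes (abstract form of Theorem 2): Fix positive integers N₀, N₁, N₂, N₃, an additive commutative group G, shift elements u_{n₀}, x_{n₁}, y_{n₂}, z_{n₃} ∈ G (0 ≤ n_k < N_k), finite-dimensional complex vector spaces A_{n₂n₃}, B_{n₁n₃}, C_{n₁n₂}, D_{n₀n₃}, E_{n₀n₂}, F_{n₀n₁}, and let W be the tensor product of all of these spaces. Suppose given operator families R^{XYZ}_{n₁n₂n₃} : G → End(W) acting as the identity outside A_{n₂n₃} ⊗ B_{n₁n₃} ⊗ C_{n₁n₂}, R^{UYZ}_{n₀n₂n₃} acting outside A_{n₂n₃} ⊗ D_{n₀n₃} ⊗ E_{n₀n₂}, R^{UXZ}_{n₀n₁n₃} acting outside B_{n₁n₃} ⊗ D_{n₀n₃} ⊗ F_{n₀n₁}, and R^{UXY}_{n₀n₁n₂} acting outside C_{n₁n₂} ⊗ E_{n₀n₂} ⊗ F_{n₀n₁}, together with scalars ρ_{n₀n₁n₂n₃} ∈ ℂ such that for every index quadruple (n₀,n₁,n₂,n₃) and every v ∈ G the local modified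 tetrahedron equation holds: R^{XYZ}_{n₁n₂n₃}(v) · R^{UYZ}_{n₀n₂n₃}(v+x_{n₁}) · R^{UXZ}_{n₀n₁n₃}(v) · R^{UXY}_{n₀n₁n₂}(v+z_{n₃}) = ρ_{n₀n₁n₂n₃} · R^{UXY}_{n₀n₁n₂}(v) · R^{UXZ}_{n₀n₁n₃}(v+y_{n₂}) · R^{UYZ}_{n₀n₂n₃}(v) · R^{XYZ}_{n₁n₂n₃}(v+u_{n₀}). Define the fused box operators by the ordered products Rf^{XYZ}(v) = ∏_{n₁=0,…,N₁−1 (ascending)} ∏_{n₂=N₂−1,…,0 (descending)} ∏_{n₃=0,…,N₃−1 (ascending)} R^{XYZ}_{n₁n₂n₃}(v + Σ_{m₁<n₁} x_{m₁} + Σ_{m₂<n₂} y_{m₂} + Σ_{m₃<n₃} z_{m₃}), and analogously Rf^{UYZ} with (n₀ ascending, n₂ descending, n₃ ascending), Rf^{UXZ} with (n₀ ascending, n₁ descending, n₃ ascending), Rf^{UXY} with (n₀ ascending, n₁ descending, n₂ ascending), always with argument v plus the sum of the shift elements of all strictly smaller indices in each of the three relevant directions. Then for every v ∈ G the fused operators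 satisfy the modified tetrahedron equation Rf^{XYZ}(v) · Rf^{UYZ}(v+I_X) · Rf^{UXZ}(v) · Rf^{UXY}(v+I_Z) = ρ · Rf^{UXY}(v) · Rf^{UXZ}(v+I_Y) · Rf^{UYZ}(v) · Rf^{XYZ}(v+I_U), where I_U = Σ_{n₀} u_{n₀}, I_X = Σ_{n₁} x_{n₁}, I_Y = Σ_{n₂} y_{n₂}, I_Z = Σ_{n₃} z_{n₃}, and ρ = ∏_{n₀,n₁,n₂,n₃} ρ_{n₀n₁n₂n₃}. -/
/-- A matrix `M` acting on the tensor product `⨂_k ℂ^{I k}` (realized as matrices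
indexed by `∀ k, I k`) *acts as the identity outside* the tensor factors in `S` if it
is of the form `T ⊗ id`: there is a matrix `T` on the factors in `S` such that
`M p q = T (p|_S) (q|_S) · δ(p|_{Sᶜ}, q|_{Sᶜ})`. -/
def ActsAsIdOutside {ι : Type*} [Fintype ι] [DecidableEq ι] {I : ι → Type*}
    [∀ k, DecidableEq (I k)] (S : Finset ι)
    (M : Matrix (∀ k, I k) (∀ k, I k) ℂ) : Prop :=
  ∃ T : ((k : S) → I k.1) → ((k : S) → I k.1) → ℂ,
    ∀ p q : ∀ k, I k,
      M p q = T (fun k => p k.1) (fun k => q k.1) *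
        (if ∀ k ∉ S, p k = q k then 1 else 0)

/-- The index set labelling the tensor factors of the total space
`W = (⨂ A_{n₂n₃}) ⊗ (⨂ B_{n₁n₃}) ⊗ (⨂ C_{n₁n₂}) ⊗ (⨂ D_{n₀n₃}) ⊗ (⨂ E_{n₀n₂}) ⊗ (⨂ F_{n₀n₁})`. -/
abbrev BoxIndex (N₀ N₁ N₂ N₃ : ℕ) : Type :=
  (Fin N₂ × Fin N₃) ⊕ ((Fin N₁ × Fin N₃) ⊕ ((Fin N₁ × Fin N₂) ⊕
    ((Fin N₀ × Fin N₃) ⊕ ((Fin N₀ × Fin N₂) ⊕ (Fin N₀ × Fin N₁)))))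

/-- Label of the factor `A_{n₂ n₃}`. -/
abbrev iA {N₀ N₁ N₂ N₃ : ℕ} (n₂ : Fin N₂) (n₃ : Fin N₃) : BoxIndex N₀ N₁ N₂ N₃ :=
  Sum.inl (n₂, n₃)
/-- Label of the factor `B_{n₁ n₃}`. -/
abbrev iB {N₀ N₁ N₂ N₃ : ℕ} (n₁ : Fin N₁) (n₃ : Fin N₃) : BoxIndex N₀ N₁ N₂ N₃ :=
  Sum.inr (Sum.inl (n₁, n₃))
/-- Label of the factor `C_{n₁ n₂}`. -/
abbrev iC {N₀ N₁ N₂ N₃ : ℕ} (n₁ : Fin N₁) (n₂ : Fin N₂) : BoxIndex N₀ N₁ N₂ N₃ :=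
  Sum.inr (Sum.inr (Sum.inl (n₁, n₂)))
/-- Label of the factor `D_{n₀ n₃}`. -/
abbrev iD {N₀ N₁ N₂ N₃ : ℕ} (n₀ : Fin N₀) (n₃ : Fin N₃) : BoxIndex N₀ N₁ N₂ N₃ :=
  Sum.inr (Sum.inr (Sum.inr (Sum.inl (n₀, n₃))))
/-- Label of the factor `E_{n₀ n₂}`. -/
abbrev iE {N₀ N₁ N₂ N₃ : ℕ} (n₀ : Fin N₀) (n₂ : Fin N₂) : BoxIndex N₀ N₁ N₂ N₃ :=
  Sum.inr (Sum.inr (Sum.inr (Sum.inr (Sum.inl (n₀, n₂)))))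
/-- Label of the factor `F_{n₀ n₁}`. -/
abbrev iF {N₀ N₁ N₂ N₃ : ℕ} (n₀ : Fin N₀) (n₁ : Fin N₁) : BoxIndex N₀ N₁ N₂ N₃ :=
  Sum.inr (Sum.inr (Sum.inr (Sum.inr (Sum.inr (n₀, n₁)))))

/-- The entries of a product of two operators supported on disjoint sets of tensor factors. -/
theorem mul_apply_of_disjoint_support {ι : Type*} [Fintype ι] [DecidableEq ι] {I : ι → Type*}
    [∀ k, Fintype (I k)] [∀ k, DecidableEq (I k)] {S T : Finset ι} (hST : Disjoint S T)
    {M M' : Matrix (∀ k, I k) (∀ k, I k) ℂ}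
    {A : ((k : S) → I k.1) → ((k : S) → I k.1) → ℂ}
    {B : ((k : T) → I k.1) → ((k : T) → I k.1) → ℂ}
    (hM : ∀ p q : ∀ k, I k, M p q = A (fun k => p k.1) (fun k => q k.1) *
      (if ∀ k ∉ S, p k = q k then 1 else 0))
    (hM' : ∀ p q : ∀ k, I k, M' p q = B (fun k => p k.1) (fun k => q k.1) *
      (if ∀ k ∉ T, p k = q k then 1 else 0)) (p q : ∀ k, I k) :
    (M * M') p q = A (fun k => p k.1) (fun k => q k.1) * B (fun k => p k.1) (fun k => q k.1) *
      (if ∀ k, k ∉ S → k ∉ T → p k = q k then 1 else 0) := by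
  have hS : ∀ k ∈ T, k ∉ S := fun k hk hk' => Finset.disjoint_left.mp hST hk' hk
  rw [Matrix.mul_apply, Finset.sum_eq_single (S.piecewise q p)]
  · have hA : (fun k : S => S.piecewise q p k) = fun k : S => q k := by
      funext k
      simp
    have hB : (fun k : T => S.piecewise q p k) = fun k : T => p k := by
      funext k
      simp [Finset.piecewise_eq_of_notMem _ _ _ (hS _ k.2)]
    have h₁ : ∀ k ∉ S, p k = S.piecewise q p k := fun k hk => by
      simp [Finset.piecewise_eq_of_notMem _ _ _ hk]
    have h₂ : (∀ k ∉ T, S.piecewise q p k = q k) ↔ ∀ k, k ∉ S → k ∉ T → p k = q k := by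
      refine forall_congr' fun k => ?_
      by_cases hk : k ∈ S <;> simp [hk]
    rw [hM, hM', hA, hB, if_pos h₁, mul_one, ← mul_assoc]
    simp only [h₂]
  · intro r _ hr
    rw [hM, hM']
    by_cases h₁ : ∀ k ∉ S, p k = r k
    · by_cases h₂ : ∀ k ∉ T, r k = q k
      · refine absurd (funext fun k => ?_) hr
        by_cases hk : k ∈ S
        · simp [hk, h₂ k (Finset.disjoint_left.mp hST hk)]
        · simp [hk, h₁ k hk]
      · simp [h₂]
    · simp [h₁]
  · simp

/-- Operators supported on disjoint sets of tensor factors commute. -/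
theorem ActsAsIdOutside.commute {ι : Type*} [Fintype ι] [DecidableEq ι] {I : ι → Type*}
    [∀ k, Fintype (I k)] [∀ k, DecidableEq (I k)] {S T : Finset ι}
    {M M' : Matrix (∀ k, I k) (∀ k, I k) ℂ} (hM : ActsAsIdOutside S M)
    (hM' : ActsAsIdOutside T M') (hST : Disjoint S T) : Commute M M' := by
  obtain ⟨A, hA⟩ := hM
  obtain ⟨B, hB⟩ := hM'
  ext p q
  rw [mul_apply_of_disjoint_support hST hA hB, mul_apply_of_disjoint_support hST.symm hB hA,
    mul_comm (A _ _)]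
  congr 2
  refine propext (forall_congr' fun k => ?_)
  tauto

section Fusion

variable {G M 𝕜 : Type*} [Semiring M]

/-- All values of `f` commute with all values of `g`. -/
def ValuesCommute (f g : G → M) : Prop := ∀ v w, Commute (f v) (g w)

/-- Values of `f` and `g` at distinct indices commute. -/
def OffDiagCommute {ι : Type*} (f g : ι → G → M) : Prop :=
  ∀ i j, i ≠ j → ValuesCommute (f i) (g j)

theorem ValuesCommute.symm {f g : G → M} (h : ValuesCommute f g) : ValuesCommute g f :=
  fun v w => (h w v).symm

theorem OffDiagCommute.zero_succ {N : ℕ} {f g : Fin (N + 1) → G → M} (h : OffDiagCommute f g)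
    (i : Fin N) : ValuesCommute (f 0) (g i.succ) :=
  h _ _ (Fin.succ_ne_zero i).symm

theorem OffDiagCommute.succ_zero {N : ℕ} {f g : Fin (N + 1) → G → M} (h : OffDiagCommute f g)
    (i : Fin N) : ValuesCommute (f i.succ) (g 0) :=
  h _ _ (Fin.succ_ne_zero i)

theorem OffDiagCommute.tail {N : ℕ} {f g : Fin (N + 1) → G → M} (h : OffDiagCommute f g) :
    OffDiagCommute (fun i : Fin N => f i.succ) fun i => g i.succ :=
  fun _ _ hij => h _ _ fun e => hij (Fin.succ_injective _ e)

theorem mul_interleave {a₁ a₂ b₁ b₂ c₁ c₂ : M} (hab : Commute a₂ b₁) (hac : Commute a₂ c₁)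
    (hbc : Commute b₂ c₁) :
    a₁ * a₂ * (b₁ * b₂) * (c₁ * c₂) = a₁ * b₁ * c₁ * (a₂ * b₂ * c₂) := by
  rw [hab.mul_mul_mul_comm, (hac.mul_left hbc).mul_mul_mul_comm]

variable [AddCommGroup G]

/-- Ordered product of a family of operators with increasing indices, each argument shifted by
the sum of the preceding shifts. -/
def fuseAsc {N : ℕ} (s : Fin N → G) (f : Fin N → G → M) (v : G) : M :=
  ((List.finRange N).map fun i => f i (v + ∑ m ∈ Finset.Iio i, s m)).prod

/-- Ordered product of a family of operators with decreasing indices, each argument shifted by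
the sum of the shifts with smaller index. -/
def fuseDesc {N : ℕ} (s : Fin N → G) (f : Fin N → G → M) (v : G) : M :=
  ((List.finRange N).reverse.map fun i => f i (v + ∑ m ∈ Finset.Iio i, s m)).prod

theorem sum_Iio_zero {N : ℕ} (s : Fin (N + 1) → G) : ∑ m ∈ Finset.Iio 0, s m = 0 := by
  simp [← Finset.filter_gt_eq_Iio]

theorem sum_Iio_succ {N : ℕ} (s : Fin (N + 1) → G) (i : Fin N) :
    ∑ m ∈ Finset.Iio i.succ, s m = s 0 + ∑ m ∈ Finset.Iio i, s m.succ := by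
  simp only [← Finset.filter_gt_eq_Iio, Finset.sum_filter, Fin.sum_univ_succ,
    Fin.succ_lt_succ_iff, Fin.succ_pos, if_true]

theorem fuseAsc_zero (s : Fin 0 → G) (f : Fin 0 → G → M) (v : G) : fuseAsc s f v = 1 := by
  simp [fuseAsc]

theorem fuseDesc_zero (s : Fin 0 → G) (f : Fin 0 → G → M) (v : G) : fuseDesc s f v = 1 := by
  simp [fuseDesc]

theorem fuseAsc_succ {N : ℕ} (s : Fin (N + 1) → G) (f : Fin (N + 1) → G → M) :
    fuseAsc s f =
      fun v => f 0 v * fuseAsc (fun i => s i.succ) (fun i => f i.succ) (v + s 0) := by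
  funext v
  simp [fuseAsc, List.finRange_succ, Function.comp_def, sum_Iio_zero, sum_Iio_succ, add_assoc]

theorem fuseDesc_succ {N : ℕ} (s : Fin (N + 1) → G) (f : Fin (N + 1) → G → M) :
    fuseDesc s f =
      fun v => fuseDesc (fun i => s i.succ) (fun i => f i.succ) (v + s 0) * f 0 v := by
  funext v
  simp [fuseDesc, List.finRange_succ, Function.comp_def, sum_Iio_zero, sum_Iio_succ, add_assoc]

theorem ValuesCommute.fuseAsc_left {N : ℕ} {s : Fin N → G} {f : Fin N → G → M} {g : G → M}
    (h : ∀ i, ValuesCommute (f i) g) : ValuesCommute (fuseAsc s f) g := by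
  intro v w
  refine Commute.list_prod_left _ _ fun a ha => ?_
  obtain ⟨i, -, rfl⟩ := List.mem_map.mp ha
  exact h i _ _

theorem ValuesCommute.fuseDesc_left {N : ℕ} {s : Fin N → G} {f : Fin N → G → M} {g : G → M}
    (h : ∀ i, ValuesCommute (f i) g) : ValuesCommute (fuseDesc s f) g := by
  intro v w
  refine Commute.list_prod_left _ _ fun a ha => ?_
  obtain ⟨i, -, rfl⟩ := List.mem_map.mp ha
  exact h i _ _

theorem ValuesCommute.fuseAsc_right {N : ℕ} {s : Fin N → G} {f : G → M} {g : Fin N → G → M}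
    (h : ∀ i, ValuesCommute f (g i)) : ValuesCommute f (fuseAsc s g) :=
  (fuseAsc_left fun i => (h i).symm).symm

theorem ValuesCommute.fuseDesc_right {N : ℕ} {s : Fin N → G} {f : G → M} {g : Fin N → G → M}
    (h : ∀ i, ValuesCommute f (g i)) : ValuesCommute f (fuseDesc s g) :=
  (fuseDesc_left fun i => (h i).symm).symm

variable [CommSemiring 𝕜] [Algebra 𝕜 M]

/-- The modified tetrahedron equation for four operator families, with scalar `c` and shifts
`u`, `x`, `y`, `z`. -/
def ModifiedTetrahedron (c : 𝕜) (u x y z : G) (P Q R S : G → M) : Prop :=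
  ∀ v, P v * Q (v + x) * R v * S (v + z) = c • (S v * R (v + y) * Q v * P (v + u))

namespace ModifiedTetrahedron

variable {c c₁ c₂ : 𝕜} {u u₁ u₂ x x₁ x₂ y y₁ y₂ z z₁ z₂ : G}
  {P P₁ P₂ Q Q₁ Q₂ R R₁ R₂ S S₁ S₂ : G → M}

/-- Composition of two modified tetrahedron equations in the direction of the shift `u`. -/
theorem glue_u (h₁ : ModifiedTetrahedron c₁ u₁ x y z P Q₁ R₁ S₁)
    (h₂ : ModifiedTetrahedron c₂ u₂ x y z P Q₂ R₂ S₂)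
    (hQR : ValuesCommute Q₂ R₁) (hQS : ValuesCommute Q₂ S₁) (hRS : ValuesCommute R₂ S₁)
    (hRQ : ValuesCommute Q₁ R₂) (hSQ : ValuesCommute Q₁ S₂) (hSR : ValuesCommute R₁ S₂) :
    ModifiedTetrahedron (c₁ * c₂) (u₁ + u₂) x y z P (fun v => Q₁ v * Q₂ (v + u₁))
      (fun v => R₁ v * R₂ (v + u₁)) (fun v => S₁ v * S₂ (v + u₁)) := by
  intro v
  have e₁ := h₁ v
  have e₂ := h₂ (v + u₁)
  simp only [add_right_comm _ x u₁, add_right_comm _ y u₁, add_right_comm _ z u₁, ← add_assoc]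
  rw [mul_assoc, mul_assoc, ← mul_assoc (_ * _) (_ * _) (_ * _),
    mul_interleave (hQR _ _) (hQS _ _) (hRS _ _),
    mul_interleave (hSR _ _).symm (hSQ _ _).symm (hRQ _ _).symm]
  simp only [mul_assoc] at e₁ e₂ ⊢
  have e₁' : ∀ t, P v * (Q₁ (v + x) * (R₁ v * (S₁ (v + z) * t))) =
      c₁ • (S₁ v * (R₁ (v + y) * (Q₁ v * (P (v + u₁) * t)))) := fun t => by
    simpa [mul_assoc] using congrArg (· * t) e₁
  rw [e₁', e₂]
  simp [mul_smul]

/-- Composition of two modified tetrahedron equations in the direction of the shift `x`. -/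
theorem glue_x (h₁ : ModifiedTetrahedron c₁ u x₁ y z P₁ Q R₁ S₁)
    (h₂ : ModifiedTetrahedron c₂ u x₂ y z P₂ Q R₂ S₂)
    (hPR : ValuesCommute P₁ R₂) (hPS : ValuesCommute P₁ S₂) (hRS : ValuesCommute R₁ S₂)
    (hRP : ValuesCommute P₂ R₁) (hSP : ValuesCommute P₂ S₁) (hSR : ValuesCommute R₂ S₁) :
    ModifiedTetrahedron (c₁ * c₂) u (x₁ + x₂) y z (fun v => P₁ v * P₂ (v + x₁)) Q
      (fun v => R₂ (v + x₁) * R₁ v) (fun v => S₂ (v + x₁) * S₁ v) := by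
  intro v
  have e₁ := h₁ v
  have e₂ := h₂ (v + x₁)
  simp only [add_right_comm _ u x₁, add_right_comm _ y x₁, add_right_comm _ z x₁, ← add_assoc]
  rw [mul_assoc _ (_ * _) (_ * _), (hRS _ _).mul_mul_mul_comm, (hSR _ _).symm.mul_mul_mul_comm]
  calc _ = P₁ v * (P₂ (v + x₁) * Q (v + x₁ + x₂) * R₂ (v + x₁) * S₂ (v + x₁ + z)) *
        (R₁ v * S₁ (v + z)) := by simp only [mul_assoc]
    _ = c₂ • (P₁ v * (S₂ (v + x₁) * R₂ (v + x₁ + y)) * Q (v + x₁) *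
        (P₂ (v + x₁ + u) * (R₁ v * S₁ (v + z)))) := by
      rw [e₂]; simp only [mul_assoc, mul_smul_comm, smul_mul_assoc]
    _ = c₂ • (S₂ (v + x₁) * R₂ (v + x₁ + y) *
        (P₁ v * Q (v + x₁) * R₁ v * S₁ (v + z)) * P₂ (v + x₁ + u)) := by
      rw [((hPS _ _).mul_right (hPR _ _)).eq, ((hRP _ _).mul_right (hSP _ _)).eq]
      simp only [mul_assoc]
    _ = _ := by
      rw [e₁]
      simp only [mul_assoc, mul_smul_comm, smul_mul_assoc, smul_smul, mul_comm c₂]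

/-- Composition of two modified tetrahedron equations in the direction of the shift `y`. -/
theorem glue_y (h₁ : ModifiedTetrahedron c₁ u x y₁ z P₁ Q₁ R S₁)
    (h₂ : ModifiedTetrahedron c₂ u x y₂ z P₂ Q₂ R S₂)
    (hPQ : ValuesCommute P₁ Q₂) (hPS : ValuesCommute P₁ S₂) (hQS : ValuesCommute Q₁ S₂)
    (hQP : ValuesCommute P₂ Q₁) (hSP : ValuesCommute P₂ S₁) (hSQ : ValuesCommute Q₂ S₁) :
    ModifiedTetrahedron (c₁ * c₂) u x (y₁ + y₂) z (fun v => P₂ (v + y₁) * P₁ v)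
      (fun v => Q₂ (v + y₁) * Q₁ v) R (fun v => S₁ v * S₂ (v + y₁)) := by
  intro v
  have e₁ := h₁ v
  have e₂ := h₂ (v + y₁)
  simp only [add_right_comm _ u y₁, add_right_comm _ x y₁, add_right_comm _ z y₁, ← add_assoc]
  rw [(hPQ _ _).mul_mul_mul_comm, mul_assoc _ (_ * _) (_ * _), (hQP _ _).symm.mul_mul_mul_comm]
  calc _ = P₂ (v + y₁) * Q₂ (v + y₁ + x) * (P₁ v * Q₁ (v + x) * R v * S₁ (v + z)) *
        S₂ (v + y₁ + z) := by simp only [mul_assoc]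
    _ = c₁ • (P₂ (v + y₁) * Q₂ (v + y₁ + x) * S₁ v * R (v + y₁) *
        (Q₁ v * P₁ (v + u) * S₂ (v + y₁ + z))) := by
      rw [e₁]; simp only [mul_assoc, mul_smul_comm, smul_mul_assoc]
    _ = c₁ • (S₁ v * (P₂ (v + y₁) * Q₂ (v + y₁ + x) * R (v + y₁) * S₂ (v + y₁ + z)) *
        (Q₁ v * P₁ (v + u))) := by
      rw [((hSP _ _).mul_left (hSQ _ _)).eq, ((hQS _ _).mul_left (hPS _ _)).eq]
      simp only [mul_assoc]
    _ = _ := by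
      rw [e₂]
      simp only [mul_assoc, mul_smul_comm, smul_mul_assoc, smul_smul]

/-- Composition of two modified tetrahedron equations in the direction of the shift `z`. -/
theorem glue_z (h₁ : ModifiedTetrahedron c₁ u x y z₁ P₁ Q₁ R₁ S)
    (h₂ : ModifiedTetrahedron c₂ u x y z₂ P₂ Q₂ R₂ S)
    (hPQ : ValuesCommute P₂ Q₁) (hPR : ValuesCommute P₂ R₁) (hQR : ValuesCommute Q₂ R₁)
    (hQP : ValuesCommute P₁ Q₂) (hRP : ValuesCommute P₁ R₂) (hRQ : ValuesCommute Q₁ R₂) :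
    ModifiedTetrahedron (c₁ * c₂) u x y (z₁ + z₂) (fun v => P₁ v * P₂ (v + z₁))
      (fun v => Q₁ v * Q₂ (v + z₁)) (fun v => R₁ v * R₂ (v + z₁)) S := by
  intro v
  have e₁ := h₁ v
  have e₂ := h₂ (v + z₁)
  simp only [add_right_comm _ u z₁, add_right_comm _ x z₁, add_right_comm _ y z₁, ← add_assoc]
  rw [mul_interleave (hPQ _ _) (hPR _ _) (hQR _ _), mul_assoc, e₂, mul_smul_comm]
  simp only [mul_assoc] at e₁ ⊢
  have e₁' : ∀ t, P₁ v * (Q₁ (v + x) * (R₁ v * (S (v + z₁) * t))) =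
      c₁ • (S v * (R₁ (v + y) * (Q₁ v * (P₁ (v + u) * t)))) := fun t => by
    simpa [mul_assoc] using congrArg (· * t) e₁
  have e := mul_interleave (a₁ := R₁ (v + y)) (b₂ := Q₂ (v + z₁)) (c₂ := P₂ (v + z₁ + u))
    (hRQ v (v + z₁ + y)).symm (hRP (v + u) (v + z₁ + y)).symm (hQP (v + u) (v + z₁)).symm
  simp only [mul_assoc] at e
  rw [e₁', e, smul_smul, mul_comm c₂]

/-- Fusion of a family of modified tetrahedron equations in the direction of the shift `u`. -/
theorem fuse_u {N : ℕ} {c : Fin N → 𝕜} {x y z : G} {u : Fin N → G}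
    {Q R S : Fin N → G → M} {P : G → M}
    (hQR : OffDiagCommute Q R) (hQS : OffDiagCommute Q S) (hRS : OffDiagCommute R S)
    (h : ∀ i, ModifiedTetrahedron (c i) (u i) x y z P (Q i) (R i) (S i)) :
    ModifiedTetrahedron (∏ i, c i) (∑ i, u i) x y z
      P (fuseAsc u Q) (fuseAsc u R) (fuseAsc u S) := by
  induction N with
  | zero => intro v; simp [fuseAsc_zero]
  | succ N ih =>
    simp only [fuseAsc_succ, Fin.prod_univ_succ, Fin.sum_univ_succ]
    exact glue_u (h 0) (ih hQR.tail hQS.tail hRS.tail fun i => h i.succ)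
      (.fuseAsc_left hQR.succ_zero) (.fuseAsc_left hQS.succ_zero) (.fuseAsc_left hRS.succ_zero)
      (.fuseAsc_right hQR.zero_succ) (.fuseAsc_right hQS.zero_succ) (.fuseAsc_right hRS.zero_succ)

/-- Fusion of a family of modified tetrahedron equations in the direction of the shift `x`. -/
theorem fuse_x {N : ℕ} {c : Fin N → 𝕜} {u y z : G} {x : Fin N → G}
    {P R S : Fin N → G → M} {Q : G → M}
    (hPR : OffDiagCommute P R) (hPS : OffDiagCommute P S) (hRS : OffDiagCommute R S)
    (h : ∀ i, ModifiedTetrahedron (c i) u (x i) y z (P i) Q (R i) (S i)) :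
    ModifiedTetrahedron (∏ i, c i) u (∑ i, x i) y z
      (fuseAsc x P) Q (fuseDesc x R) (fuseDesc x S) := by
  induction N with
  | zero => intro v; simp [fuseAsc_zero, fuseDesc_zero]
  | succ N ih =>
    simp only [fuseAsc_succ, fuseDesc_succ, Fin.prod_univ_succ, Fin.sum_univ_succ]
    exact glue_x (h 0) (ih hPR.tail hPS.tail hRS.tail fun i => h i.succ)
      (.fuseDesc_right hPR.zero_succ) (.fuseDesc_right hPS.zero_succ) (.fuseDesc_right hRS.zero_succ)
      (.fuseAsc_left hPR.succ_zero) (.fuseAsc_left hPS.succ_zero) (.fuseDesc_left hRS.succ_zero)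

/-- Fusion of a family of modified tetrahedron equations in the direction of the shift `y`. -/
theorem fuse_y {N : ℕ} {c : Fin N → 𝕜} {u x z : G} {y : Fin N → G}
    {P Q S : Fin N → G → M} {R : G → M}
    (hPQ : OffDiagCommute P Q) (hPS : OffDiagCommute P S) (hQS : OffDiagCommute Q S)
    (h : ∀ i, ModifiedTetrahedron (c i) u x (y i) z (P i) (Q i) R (S i)) :
    ModifiedTetrahedron (∏ i, c i) u x (∑ i, y i) z
      (fuseDesc y P) (fuseDesc y Q) R (fuseAsc y S) := by
  induction N with
  | zero => intro v; simp [fuseAsc_zero, fuseDesc_zero]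
  | succ N ih =>
    simp only [fuseAsc_succ, fuseDesc_succ, Fin.prod_univ_succ, Fin.sum_univ_succ]
    exact glue_y (h 0) (ih hPQ.tail hPS.tail hQS.tail fun i => h i.succ)
      (.fuseDesc_right hPQ.zero_succ) (.fuseAsc_right hPS.zero_succ) (.fuseAsc_right hQS.zero_succ)
      (.fuseDesc_left hPQ.succ_zero) (.fuseDesc_left hPS.succ_zero) (.fuseDesc_left hQS.succ_zero)

/-- Fusion of a family of modified tetrahedron equations in the direction of the shift `z`. -/
theorem fuse_z {N : ℕ} {c : Fin N → 𝕜} {u x y : G} {z : Fin N → G}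
    {P Q R : Fin N → G → M} {S : G → M}
    (hPQ : OffDiagCommute P Q) (hPR : OffDiagCommute P R) (hQR : OffDiagCommute Q R)
    (h : ∀ i, ModifiedTetrahedron (c i) u x y (z i) (P i) (Q i) (R i) S) :
    ModifiedTetrahedron (∏ i, c i) u x y (∑ i, z i)
      (fuseAsc z P) (fuseAsc z Q) (fuseAsc z R) S := by
  induction N with
  | zero => intro v; simp [fuseAsc_zero]
  | succ N ih =>
    simp only [fuseAsc_succ, Fin.prod_univ_succ, Fin.sum_univ_succ]
    exact glue_z (h 0) (ih hPQ.tail hPR.tail hQR.tail fun i => h i.succ)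
      (.fuseAsc_left hPQ.succ_zero) (.fuseAsc_left hPR.succ_zero) (.fuseAsc_left hQR.succ_zero)
      (.fuseAsc_right hPQ.zero_succ) (.fuseAsc_right hPR.zero_succ) (.fuseAsc_right hQR.zero_succ)

/-- Fusion over an open box, from the local equations and the commutation relations between
operators with disjoint supports. -/
theorem fuse_box {N₀ N₁ N₂ N₃ : ℕ} {c : Fin N₀ → Fin N₁ → Fin N₂ → Fin N₃ → 𝕜}
    {u : Fin N₀ → G} {x : Fin N₁ → G} {y : Fin N₂ → G} {z : Fin N₃ → G}
    {P : Fin N₁ → Fin N₂ → Fin N₃ → G → M} {Q : Fin N₀ → Fin N₂ → Fin N₃ → G → M}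
    {R : Fin N₀ → Fin N₁ → Fin N₃ → G → M} {S : Fin N₀ → Fin N₁ → Fin N₂ → G → M}
    (hPQ : ∀ n₁ n₂ n₃ n₀ m₂ m₃, n₂ ≠ m₂ ∨ n₃ ≠ m₃ → ValuesCommute (P n₁ n₂ n₃) (Q n₀ m₂ m₃))
    (hPR : ∀ n₁ n₂ n₃ n₀ m₁ m₃, n₁ ≠ m₁ ∨ n₃ ≠ m₃ → ValuesCommute (P n₁ n₂ n₃) (R n₀ m₁ m₃))
    (hPS : ∀ n₁ n₂ n₃ n₀ m₁ m₂, n₁ ≠ m₁ ∨ n₂ ≠ m₂ → ValuesCommute (P n₁ n₂ n₃) (S n₀ m₁ m₂))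
    (hQR : ∀ n₀ n₂ n₃ m₀ m₁ m₃, n₀ ≠ m₀ ∨ n₃ ≠ m₃ → ValuesCommute (Q n₀ n₂ n₃) (R m₀ m₁ m₃))
    (hQS : ∀ n₀ n₂ n₃ m₀ m₁ m₂, n₀ ≠ m₀ ∨ n₂ ≠ m₂ → ValuesCommute (Q n₀ n₂ n₃) (S m₀ m₁ m₂))
    (hRS : ∀ n₀ n₁ n₃ m₀ m₁ m₂, n₀ ≠ m₀ ∨ n₁ ≠ m₁ → ValuesCommute (R n₀ n₁ n₃) (S m₀ m₁ m₂))
    (h : ∀ n₀ n₁ n₂ n₃, ModifiedTetrahedron (c n₀ n₁ n₂ n₃) (u n₀) (x n₁) (y n₂) (z n₃)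
      (P n₁ n₂ n₃) (Q n₀ n₂ n₃) (R n₀ n₁ n₃) (S n₀ n₁ n₂)) :
    ModifiedTetrahedron (∏ n₀, ∏ n₁, ∏ n₂, ∏ n₃, c n₀ n₁ n₂ n₃)
      (∑ i, u i) (∑ i, x i) (∑ i, y i) (∑ i, z i)
      (fuseAsc x fun n₁ => fuseDesc y fun n₂ => fuseAsc z (P n₁ n₂))
      (fuseAsc u fun n₀ => fuseDesc y fun n₂ => fuseAsc z (Q n₀ n₂))
      (fuseAsc u fun n₀ => fuseDesc x fun n₁ => fuseAsc z (R n₀ n₁))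
      (fuseAsc u fun n₀ => fuseDesc x fun n₁ => fuseAsc y (S n₀ n₁)) := by
  refine fuse_u ?_ ?_ ?_ fun n₀ =>
    fuse_x ?_ ?_ ?_ fun n₁ =>
    fuse_y ?_ ?_ ?_ fun n₂ =>
    fuse_z ?_ ?_ ?_ fun n₃ => h n₀ n₁ n₂ n₃
  · exact fun _ _ h => .fuseDesc_left fun _ => .fuseAsc_left fun _ => .fuseDesc_right fun _ =>
      .fuseAsc_right fun _ => hQR _ _ _ _ _ _ (.inl h)
  · exact fun _ _ h => .fuseDesc_left fun _ => .fuseAsc_left fun _ => .fuseDesc_right fun _ =>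
      .fuseAsc_right fun _ => hQS _ _ _ _ _ _ (.inl h)
  · exact fun _ _ h => .fuseDesc_left fun _ => .fuseAsc_left fun _ => .fuseDesc_right fun _ =>
      .fuseAsc_right fun _ => hRS _ _ _ _ _ _ (.inl h)
  · exact fun _ _ h => .fuseDesc_left fun _ => .fuseAsc_left fun _ => .fuseAsc_right fun _ =>
      hPR _ _ _ _ _ _ (.inl h)
  · exact fun _ _ h => .fuseDesc_left fun _ => .fuseAsc_left fun _ => .fuseAsc_right fun _ =>
      hPS _ _ _ _ _ _ (.inl h)
  · exact fun _ _ h => .fuseAsc_left fun _ => .fuseAsc_right fun _ => hRS _ _ _ _ _ _ (.inr h)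
  · exact fun _ _ h => .fuseAsc_left fun _ => .fuseAsc_right fun _ => hPQ _ _ _ _ _ _ (.inl h)
  · exact fun _ _ h => .fuseAsc_left fun _ => hPS _ _ _ _ _ _ (.inr h)
  · exact fun _ _ h => .fuseAsc_left fun _ => hQS _ _ _ _ _ _ (.inr h)
  · exact fun _ _ h => hPQ _ _ _ _ _ _ (.inr h)
  · exact fun _ _ h => hPR _ _ _ _ _ _ (.inr h)
  · exact fun _ _ h => hQR _ _ _ _ _ _ (.inr h)

end ModifiedTetrahedron

end Fusion

/-- Fused modified tetrahedron equation for open boxes (abstract form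
of Theorem 2 of the paper): if the local vertex weights, acting as the identity outside
their three specified tensor factors, satisfy the local modified tetrahedron equations
with compatible shifts, then the fused box weights (ordered products with shifted
arguments) satisfy the modified tetrahedron equation with total shifts
`I_U = Σ u`, `I_X = Σ x`, `I_Y = Σ y`, `I_Z = Σ z` and scalar `ρ = ∏ ρ_{n₀n₁n₂n₃}`. -/
theorem fused_box_mte (N₀ N₁ N₂ N₃ : ℕ)
    (hN₀ : 0 < N₀) (hN₁ : 0 < N₁) (hN₂ : 0 < N₂) (hN₃ : 0 < N₃)
    {G : Type*} [AddCommGroup G]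
    (u : Fin N₀ → G) (x : Fin N₁ → G) (y : Fin N₂ → G) (z : Fin N₃ → G)
    {I : BoxIndex N₀ N₁ N₂ N₃ → Type*} [∀ k, Fintype (I k)] [∀ k, DecidableEq (I k)]
    (RXYZ : Fin N₁ → Fin N₂ → Fin N₃ → G → Matrix (∀ k, I k) (∀ k, I k) ℂ)
    (RUYZ : Fin N₀ → Fin N₂ → Fin N₃ → G → Matrix (∀ k, I k) (∀ k, I k) ℂ)
    (RUXZ : Fin N₀ → Fin N₁ → Fin N₃ → G → Matrix (∀ k, I k) (∀ k, I k) ℂ)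
    (RUXY : Fin N₀ → Fin N₁ → Fin N₂ → G → Matrix (∀ k, I k) (∀ k, I k) ℂ)
    (ρ : Fin N₀ → Fin N₁ → Fin N₂ → Fin N₃ → ℂ)
    (hXYZsupp : ∀ n₁ n₂ n₃ v,
      ActsAsIdOutside {iA n₂ n₃, iB n₁ n₃, iC n₁ n₂} (RXYZ n₁ n₂ n₃ v))
    (hUYZsupp : ∀ n₀ n₂ n₃ v,
      ActsAsIdOutside {iA n₂ n₃, iD n₀ n₃, iE n₀ n₂} (RUYZ n₀ n₂ n₃ v))
    (hUXZsupp : ∀ n₀ n₁ n₃ v,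
      ActsAsIdOutside {iB n₁ n₃, iD n₀ n₃, iF n₀ n₁} (RUXZ n₀ n₁ n₃ v))
    (hUXYsupp : ∀ n₀ n₁ n₂ v,
      ActsAsIdOutside {iC n₁ n₂, iE n₀ n₂, iF n₀ n₁} (RUXY n₀ n₁ n₂ v))
    (hMTE : ∀ n₀ n₁ n₂ n₃, ∀ v : G,
      RXYZ n₁ n₂ n₃ v * RUYZ n₀ n₂ n₃ (v + x n₁) * RUXZ n₀ n₁ n₃ v *
          RUXY n₀ n₁ n₂ (v + z n₃) =
        ρ n₀ n₁ n₂ n₃ • (RUXY n₀ n₁ n₂ v * RUXZ n₀ n₁ n₃ (v + y n₂) *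
          RUYZ n₀ n₂ n₃ v * RXYZ n₁ n₂ n₃ (v + u n₀)))
    (RfXYZ RfUYZ RfUXZ RfUXY : G → Matrix (∀ k, I k) (∀ k, I k) ℂ)
    (hRfXYZ : ∀ v, RfXYZ v =
      ((List.finRange N₁).map (fun n₁ =>
        (((List.finRange N₂).reverse).map (fun n₂ =>
          ((List.finRange N₃).map (fun n₃ =>
            RXYZ n₁ n₂ n₃ (v + ∑ m₁ ∈ Finset.Iio n₁, x m₁ +
              ∑ m₂ ∈ Finset.Iio n₂, y m₂ + ∑ m₃ ∈ Finset.Iio n₃, z m₃))).prod)).prod)).prod)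
    (hRfUYZ : ∀ v, RfUYZ v =
      ((List.finRange N₀).map (fun n₀ =>
        (((List.finRange N₂).reverse).map (fun n₂ =>
          ((List.finRange N₃).map (fun n₃ =>
            RUYZ n₀ n₂ n₃ (v + ∑ m₀ ∈ Finset.Iio n₀, u m₀ +
              ∑ m₂ ∈ Finset.Iio n₂, y m₂ + ∑ m₃ ∈ Finset.Iio n₃, z m₃))).prod)).prod)).prod)
    (hRfUXZ : ∀ v, RfUXZ v =
      ((List.finRange N₀).map (fun n₀ =>
        (((List.finRange N₁).reverse).map (fun n₁ =>
          ((List.finRange N₃).map (fun n₃ =>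
            RUXZ n₀ n₁ n₃ (v + ∑ m₀ ∈ Finset.Iio n₀, u m₀ +
              ∑ m₁ ∈ Finset.Iio n₁, x m₁ + ∑ m₃ ∈ Finset.Iio n₃, z m₃))).prod)).prod)).prod)
    (hRfUXY : ∀ v, RfUXY v =
      ((List.finRange N₀).map (fun n₀ =>
        (((List.finRange N₁).reverse).map (fun n₁ =>
          ((List.finRange N₂).map (fun n₂ =>
            RUXY n₀ n₁ n₂ (v + ∑ m₀ ∈ Finset.Iio n₀, u m₀ +
              ∑ m₁ ∈ Finset.Iio n₁, x m₁ + ∑ m₂ ∈ Finset.Iio n₂, y m₂))).prod)).prod)).prod) :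
    ∀ v : G,
      RfXYZ v * RfUYZ (v + ∑ n₁, x n₁) * RfUXZ v * RfUXY (v + ∑ n₃, z n₃) =
        (∏ n₀, ∏ n₁, ∏ n₂, ∏ n₃, ρ n₀ n₁ n₂ n₃) •
          (RfUXY v * RfUXZ (v + ∑ n₂, y n₂) * RfUYZ v * RfXYZ (v + ∑ n₀, u n₀)) := by
  set_option synthInstance.maxSize 1000 in
  · obtain rfl : RfXYZ = fuseAsc x fun n₁ => fuseDesc y fun n₂ => fuseAsc z (RXYZ n₁ n₂) :=
      funext hRfXYZ
    obtain rfl : RfUYZ = fuseAsc u fun n₀ => fuseDesc y fun n₂ => fuseAsc z (RUYZ n₀ n₂) :=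
      funext hRfUYZ
    obtain rfl : RfUXZ = fuseAsc u fun n₀ => fuseDesc x fun n₁ => fuseAsc z (RUXZ n₀ n₁) :=
      funext hRfUXZ
    obtain rfl : RfUXY = fuseAsc u fun n₀ => fuseDesc x fun n₁ => fuseAsc y (RUXY n₀ n₁) :=
      funext hRfUXY
    exact ModifiedTetrahedron.fuse_box (P := RXYZ) (Q := RUYZ) (R := RUXZ) (S := RUXY)
      (fun _ _ _ _ _ _ h _ _ => (hXYZsupp _ _ _ _).commute (hUYZsupp _ _ _ _) (by simp; tauto))
      (fun _ _ _ _ _ _ h _ _ => (hXYZsupp _ _ _ _).commute (hUXZsupp _ _ _ _) (by simp; tauto))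
      (fun _ _ _ _ _ _ h _ _ => (hXYZsupp _ _ _ _).commute (hUXYsupp _ _ _ _) (by simp; tauto))
      (fun _ _ _ _ _ _ h _ _ => (hUYZsupp _ _ _ _).commute (hUXZsupp _ _ _ _) (by simp; tauto))
      (fun _ _ _ _ _ _ h _ _ => (hUYZsupp _ _ _ _).commute (hUXYsupp _ _ _ _) (by simp; tauto))
      (fun _ _ _ _ _ _ h _ _ => (hUXZsupp _ _ _ _).commute (hUXYsupp _ _ _ _) (by simp; tauto))
      hMTE
end
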